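/- The extended polytope P_ext, defined as the convex hull in ℝ^6 of the vectors e_j (0 ≤ j ≤ 5) and f_j = ρ − 2e_j (0 ≤ j ≤ 5) where ρ = (1/2,…,1/2), equals the set {α ∈ ℝ^6 : Σ_{i=0}^{5} α_i = 1 and α_r + α_s ≤ 1 for all 0 ≤ r < s ≤ 5}. -/

import Mathlib

noncomputable section

/-- Standard basis vector `e i` of `ℝ^6`. -/
def e (i : Fin 6) : Fin 6 → ℝ := fun k => if k = i then 1 else 0

/-- The vector `ρ = (1/2, …, 1/2)` in `ℝ^6`. -/
def ρ : Fin 6 → ℝ := fun _ => 1 / 2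

/-- The extended polytope `P_ext`: the convex hull of the vectors `e_j` and
`f_j = ρ - 2 e_j` for `0 ≤ j ≤ 5`. -/
def Pext : Set (Fin 6 → ℝ) :=
  convexHull ℝ ({x | ∃ j : Fin 6, x = e j} ∪ {x | ∃ j : Fin 6, x = ρ - (2 : ℝ) • e j})

/-- Every `α` with coordinate sum `1` and all coordinates at most `1/2` is a convex combination of
the vectors `ρ - 2 e_j`. -/
lemma mem_Pext_of_le_half {α : Fin 6 → ℝ} (hsum : ∑ i, α i = 1) (hα : ∀ i, α i ≤ 1 / 2) :
    α ∈ Pext := by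
  have key : α = ∑ j, ((1 / 2 - α j) / 2) • (ρ - (2 : ℝ) • e j) := by
    rw [Fin.sum_univ_six] at hsum
    ext i
    fin_cases i <;> simp [Fin.sum_univ_six, e, ρ] <;> linarith
  rw [key]
  refine (convex_convexHull ℝ _).sum_mem (fun j _ => ?_) ?_
    (fun j _ => subset_convexHull ℝ _ (Or.inr ⟨j, rfl⟩))
  · linarith [hα j]
  · rw [Fin.sum_univ_six] at hsum ⊢
    linarith

/-- If `1/2 ≤ α k`, then `α` is a convex combination of `e_k` and the `ρ - 2 e_j` with `j ≠ k`. -/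
lemma mem_Pext_of_half_le {α : Fin 6 → ℝ} (hsum : ∑ i, α i = 1)
    (hα : ∀ r s, r ≠ s → α r + α s ≤ 1) {k : Fin 6} (hk : 1 / 2 ≤ α k) : α ∈ Pext := by
  have key : α = ∑ j, (if j = k then 2 * α k - 1 else (1 - α j - α k) / 2) •
      (if j = k then e j else ρ - (2 : ℝ) • e j) := by
    rw [Fin.sum_univ_six] at hsum
    ext i
    fin_cases k <;> fin_cases i <;> simp [Fin.sum_univ_six, e, ρ] <;> linarith
  rw [key]
  refine (convex_convexHull ℝ _).sum_mem (fun j _ => ?_) ?_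
    (fun j _ => subset_convexHull ℝ _ ?_)
  · split_ifs with h
    · linarith
    · linarith [hα j k h]
  · rw [Fin.sum_univ_six] at hsum ⊢
    fin_cases k <;> simp <;> linarith
  · split_ifs
    · exact Or.inl ⟨j, rfl⟩
    · exact Or.inr ⟨j, rfl⟩

theorem statement9 :
    Pext =
      {α : Fin 6 → ℝ | (∑ i, α i) = 1 ∧ ∀ r s : Fin 6, r < s → α r + α s ≤ 1} := by
  apply Set.Subset.antisymm
  · refine convexHull_min ?_ ?_
    · rintro x (⟨j, rfl⟩ | ⟨j, rfl⟩)
      · refine ⟨by simp [e], fun r s hrs => ?_⟩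
        have := hrs.ne
        simp only [e]
        split_ifs <;> first | omega | norm_num
      · refine ⟨?_, fun r s _ => ?_⟩
        · simp [e, ρ, Finset.sum_sub_distrib]
          norm_num
        · simp only [e, ρ, Pi.sub_apply, Pi.smul_apply, smul_eq_mul]
          split_ifs <;> norm_num
    · rintro x ⟨hx, hx'⟩ y ⟨hy, hy'⟩ a b ha hb hab
      refine ⟨?_, fun r s hrs => ?_⟩
      · simp [Finset.sum_add_distrib, ← Finset.mul_sum, hx, hy, hab]
      · simp only [Pi.add_apply, Pi.smul_apply, smul_eq_mul]
        nlinarith [mul_le_mul_of_nonneg_left (hx' r s hrs) ha,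
          mul_le_mul_of_nonneg_left (hy' r s hrs) hb]
  · rintro α ⟨hsum, hα⟩
    by_cases h : ∀ i, α i ≤ 1 / 2
    · exact mem_Pext_of_le_half hsum h
    · push Not at h
      obtain ⟨k, hk⟩ := h
      refine mem_Pext_of_half_le hsum (fun r s hrs => ?_) hk.le
      rcases lt_or_gt_of_ne hrs with h | h
      · exact hα r s h
      · linarith [hα s r h]
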